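/- (Deformed affine Cartan determinant of type D^{(2)}_{ℓ+1}.) Let ℓ ≥ 2 be an integer and let s, σ be nonzero complex numbers. Define the (ℓ+1)×(ℓ+1) complex matrix Ĉ = (C_{i,j})_{i,j=0,…,ℓ} by: C_{0,0} = C_{ℓ,ℓ} = s σ + s⁻¹ σ⁻¹; C_{i,i} = s + s⁻¹ for 1 ≤ i ≤ ℓ−1; C_{0,1} = −(σ + σ⁻¹); C_{1,0} = −1; C_{ℓ,ℓ−1} = −(σ + σ⁻¹); C_{ℓ−1,ℓ} = −1; C_{i,i+1} = C_{i+1,i} = −1 for 1 ≤ i ≤ ℓ−2; all other entries 0. Then det Ĉ = (s − s⁻¹)(s^{ℓ} σ² − s^{−ℓ} σ^{−2}). -/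

import Mathlib

/-- The `n × n` tridiagonal matrix with diagonal `d`, superdiagonal `u` and subdiagonal `l`. -/
def tridiagonal {R : Type*} [Zero R] (d u l : ℕ → R) (n : ℕ) : Matrix (Fin n) (Fin n) R :=
  Matrix.of fun i j =>
    if i.val = j.val then d i
    else if i.val + 1 = j.val then u i
    else if j.val + 1 = i.val then l j
    else 0

theorem det_tridiagonal_succ_succ {R : Type*} [CommRing R] (d u l : ℕ → R) (n : ℕ) :
    (tridiagonal d u l (n + 2)).det =
      d 0 * (tridiagonal (fun k => d (k + 1)) (fun k => u (k + 1)) (fun k => l (k + 1))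
        (n + 1)).det -
      u 0 * l 0 * (tridiagonal (fun k => d (k + 2)) (fun k => u (k + 2)) (fun k => l (k + 2))
        n).det := by
  have h₁ : (tridiagonal d u l (n + 2)).submatrix Fin.succ (Fin.succAbove 0) =
      tridiagonal (fun k => d (k + 1)) (fun k => u (k + 1)) (fun k => l (k + 1)) (n + 1) := by
    ext i j
    simp [tridiagonal]
  have h₂ : ((tridiagonal d u l (n + 2)).submatrix Fin.succ (Fin.succAbove 1)).det =
      l 0 * (tridiagonal (fun k => d (k + 2)) (fun k => u (k + 2)) (fun k => l (k + 2))
        n).det := by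
    rw [Matrix.det_succ_column_zero, Fin.sum_univ_succ, Finset.sum_eq_zero]
    · have h : ((tridiagonal d u l (n + 2)).submatrix Fin.succ (Fin.succAbove 1)).submatrix
          (Fin.succAbove 0) Fin.succ =
          tridiagonal (fun k => d (k + 2)) (fun k => u (k + 2)) (fun k => l (k + 2)) n := by
        ext i j
        simp [tridiagonal, Fin.succAbove, Fin.lt_def]
      rw [h]
      simp [tridiagonal]
    · intro i _
      simp [tridiagonal]
  rw [Matrix.det_succ_row_zero, Fin.sum_univ_succ, Fin.sum_univ_succ, Finset.sum_eq_zero]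
  · have e : (Fin.succ 0 : Fin (n + 2)) = 1 := rfl
    rw [h₁, e, h₂]
    simp [tridiagonal]
    ring
  · intro i _
    simp [tridiagonal]

/-- The tridiagonal determinant whose diagonal is `s + s⁻¹` except for its last entry. -/
theorem det_tridiagonal_tail {K : Type*} [Field K] {s σ : K} (hs : s ≠ 0) (hσ : σ ≠ 0) (m : ℕ) :
    ∀ d u l : ℕ → K, (∀ k < m, d k = s + s⁻¹) → d m = s * σ + s⁻¹ * σ⁻¹ →
      (∀ k, k + 1 < m → u k * l k = 1) → (∀ k, k + 1 = m → u k * l k = σ + σ⁻¹) →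
      (tridiagonal d u l (m + 1)).det = s ^ (m + 1) * σ + (s ^ (m + 1))⁻¹ * σ⁻¹ := by
  induction m using Nat.strong_induction_on with
  | _ m ih =>
    intro d u l hd hdm hul hulm
    match m with
    | 0 => simp [tridiagonal, hdm]
    | 1 =>
      rw [det_tridiagonal_succ_succ, hulm 0 rfl, hd 0 one_pos]
      simp [tridiagonal, hdm]
      field_simp
      ring
    | m + 2 =>
      rw [det_tridiagonal_succ_succ, hul 0 (by omega), hd 0 (by omega),
        ih (m + 1) (by omega) _ _ _ (fun k hk => hd (k + 1) (by omega)) hdm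
          (fun k hk => hul (k + 1) (by omega)) (fun k hk => hulm (k + 1) (by omega)),
        ih m (by omega) _ _ _ (fun k hk => hd (k + 2) (by omega)) hdm
          (fun k hk => hul (k + 2) (by omega)) (fun k hk => hulm (k + 2) (by omega))]
      field_simp
      ring

/-- determinant of the deformed affine Cartan matrix of type D^{(2)}_{ℓ+1}. -/
theorem det_deformed_cartan_D2
    (ℓ : ℕ) (hℓ : 2 ≤ ℓ) (s σ : ℂ) (hs : s ≠ 0) (hσ : σ ≠ 0)
    (C : Matrix (Fin (ℓ + 1)) (Fin (ℓ + 1)) ℂ)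
    (hC : ∀ i j : Fin (ℓ + 1), C i j =
      if i = j then
        (if i.val = 0 ∨ i.val = ℓ then s * σ + s⁻¹ * σ⁻¹ else s + s⁻¹)
      else if i.val = 0 ∧ j.val = 1 then -(σ + σ⁻¹)
      else if i.val = ℓ ∧ j.val + 1 = ℓ then -(σ + σ⁻¹)
      else if i.val + 1 = j.val ∨ j.val + 1 = i.val then -1
      else 0) :
    C.det = (s - s⁻¹) * (s ^ ℓ * σ ^ 2 - (s ^ ℓ)⁻¹ * (σ ^ 2)⁻¹) := by
  obtain ⟨m, rfl⟩ := Nat.exists_eq_add_of_le' hℓ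
  have hT : C = tridiagonal
      (fun k => if k = 0 ∨ k = m + 2 then s * σ + s⁻¹ * σ⁻¹ else s + s⁻¹)
      (fun k => if k = 0 then -(σ + σ⁻¹) else -1)
      (fun k => if k = m + 1 then -(σ + σ⁻¹) else -1) (m + 3) := by
    ext i j
    rw [hC]
    simp only [tridiagonal, Matrix.of_apply, Fin.ext_iff]
    split_ifs <;> first | rfl | omega
  rw [hT, det_tridiagonal_succ_succ, det_tridiagonal_tail hs hσ (m + 1),
    det_tridiagonal_tail hs hσ m]
  · simp
    field_simp
    ring
  all_goals intros
  all_goals grind
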